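/- For every ∅'-computable (total, rational-valued) martingale M and every low set L, there exists a set B ⊆ ℕ on which M does not succeed and such that L ⊕ B is low. -/

import Mathlib

/-!
Preamble: oracle computability, Turing reducibility, the jump, martingales,
and Martin-Löf randomness, developed from scratch.
-/

open scoped Classical

/-- The characteristic function of a set of naturals. -/
noncomputable def chi (A : Set ℕ) : ℕ → ℕ :=
  fun n => if n ∈ A then 1 else 0

/-- Partial functions recursive in a (total) oracle `O : ℕ → ℕ`.
This mirrors `Nat.Partrec`, with an additional constructor for the oracle. -/
inductive RecIn (O : ℕ → ℕ) : (ℕ →. ℕ) → Prop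
  | oracle : RecIn O (fun n => Part.some (O n))
  | zero : RecIn O (fun _ => Part.some 0)
  | succ : RecIn O (fun n => Part.some (n + 1))
  | left : RecIn O (fun n => Part.some (Nat.unpair n).1)
  | right : RecIn O (fun n => Part.some (Nat.unpair n).2)
  | pair {f g} : RecIn O f → RecIn O g → RecIn O (fun n => Nat.pair <$> f n <*> g n)
  | comp {f g} : RecIn O f → RecIn O g → RecIn O (fun n => g n >>= f)
  | prec {f g} :
      RecIn O f → RecIn O g →
      RecIn O
        (Nat.unpaired fun a n =>
          n.rec (f a) fun y IH => do
            let i ← IH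
            g (Nat.pair a (Nat.pair y i)))
  | rfind {f} :
      RecIn O f →
      RecIn O (fun a => Nat.rfind fun n => (fun m => m = 0) <$> f (Nat.pair a n))

/-- Codes for oracle machines. -/
inductive OCode : Type
  | zero : OCode
  | succ : OCode
  | left : OCode
  | right : OCode
  | oracle : OCode
  | pair : OCode → OCode → OCode
  | comp : OCode → OCode → OCode
  | prec : OCode → OCode → OCode
  | rfind' : OCode → OCode

/-- Evaluation of oracle codes relative to a total oracle. -/
def evalo (O : ℕ → ℕ) : OCode → ℕ →. ℕ
  | .zero => fun _ => Part.some 0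
  | .succ => fun n => Part.some (n + 1)
  | .left => fun n => Part.some (Nat.unpair n).1
  | .right => fun n => Part.some (Nat.unpair n).2
  | .oracle => fun n => Part.some (O n)
  | .pair cf cg => fun n => Nat.pair <$> evalo O cf n <*> evalo O cg n
  | .comp cf cg => fun n => evalo O cg n >>= evalo O cf
  | .prec cf cg =>
      Nat.unpaired fun a n =>
        n.rec (evalo O cf a) fun y IH => do
          let i ← IH
          evalo O cg (Nat.pair a (Nat.pair y i))
  | .rfind' cf =>
      Nat.unpaired fun a m =>
        (Nat.rfind fun n => (fun x => x = 0) <$> evalo O cf (Nat.pair a (n + m))).map (· + m)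

/-- A surjective listing of oracle codes. -/
def ofNatOCode : ℕ → OCode
  | 0 => .zero
  | 1 => .succ
  | 2 => .left
  | 3 => .right
  | 4 => .oracle
  | n + 5 =>
    have hm : n.div2.div2 < n + 5 := by
      rw [Nat.div2_val, Nat.div2_val]
      exact lt_of_le_of_lt (le_trans (Nat.div_le_self _ _) (Nat.div_le_self _ _))
        (Nat.lt_succ_of_le (Nat.le_add_right _ 4))
    have _m1 : n.div2.div2.unpair.1 < n + 5 :=
      lt_of_le_of_lt (Nat.unpair_left_le _) hm
    have _m2 : n.div2.div2.unpair.2 < n + 5 :=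
      lt_of_le_of_lt (Nat.unpair_right_le _) hm
    match n.bodd, n.div2.bodd with
    | false, false => .pair (ofNatOCode n.div2.div2.unpair.1) (ofNatOCode n.div2.div2.unpair.2)
    | false, true  => .comp (ofNatOCode n.div2.div2.unpair.1) (ofNatOCode n.div2.div2.unpair.2)
    | true , false => .prec (ofNatOCode n.div2.div2.unpair.1) (ofNatOCode n.div2.div2.unpair.2)
    | true , true  => .rfind' (ofNatOCode n.div2.div2)

/-- `Phi O e` is the `e`-th partial `O`-computable function `Φ_e^O`. -/
def Phi (O : ℕ → ℕ) (e : ℕ) : ℕ →. ℕ := evalo O (ofNatOCode e)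

/-- The Turing jump `A'` of a set `A`. -/
noncomputable def jump (A : Set ℕ) : Set ℕ := {e | (Phi (chi A) e e).Dom}

/-- The halting set `∅'`. -/
noncomputable def K : Set ℕ := jump ∅

/-- Turing reducibility between sets: `TRed B A` means `B ≤_T A`. -/
noncomputable def TRed (B A : Set ℕ) : Prop :=
  RecIn (chi A) (fun n => Part.some (chi B n))

/-- The effective join of two sets. -/
def join (A B : Set ℕ) : Set ℕ :=
  {n | (∃ a ∈ A, n = 2 * a) ∨ (∃ b ∈ B, n = 2 * b + 1)}

/-- A set is low if its jump is Turing reducible to `∅'`. -/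
noncomputable def Low (L : Set ℕ) : Prop := TRed (jump L) K

/-- The function `f : α → β` presented as an oracle on `ℕ`, via the encodings. -/
def fnOracle {α β : Type} [Encodable α] [Encodable β] (f : α → β) : ℕ → ℕ :=
  fun n => Encodable.encode ((Encodable.decode (α := α) n).map f)

/-- `FRed f A` means the function `f` is Turing reducible to the set `A`. -/
noncomputable def FRed {α β : Type} [Encodable α] [Encodable β] (f : α → β) (A : Set ℕ) : Prop :=
  RecIn (chi A) (fun n => Part.some (fnOracle f n))

/-- `FFRed g f` means the function `g` is Turing reducible to the function `f`. -/
def FFRed {α β γ δ : Type} [Encodable α] [Encodable β] [Encodable γ] [Encodable δ]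
    (g : γ → δ) (f : α → β) : Prop :=
  RecIn (fnOracle f) (fun n => Part.some (fnOracle g n))

/-- A martingale: a nonnegative rational-valued function on finite binary strings
satisfying the averaging condition `2 M(σ) = M(σ0) + M(σ1)`. -/
def IsMartingale (M : List Bool → ℚ) : Prop :=
  (∀ σ, 0 ≤ M σ) ∧ ∀ σ, 2 * M σ = M (σ ++ [false]) + M (σ ++ [true])

/-- The length-`n` initial segment of the characteristic sequence of `A`. -/
noncomputable def seg (A : Set ℕ) (n : ℕ) : List Bool :=
  (List.range n).map fun i => if i ∈ A then true else false

/-- A martingale succeeds on a set `A` if `limsup_n M(A↾n) = ∞`. -/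
noncomputable def Succeeds (M : List Bool → ℚ) (A : Set ℕ) : Prop :=
  ∀ q : ℚ, ∃ n, q < M (seg A n)

/-- `H(A)`: the mass problem of infinite subsets or cosubsets of `A`. -/
def Hset (A : Set ℕ) : Set (Set ℕ) :=
  {S | S.Infinite ∧ (S ⊆ A ∨ S ⊆ Aᶜ)}

/-- Muchnik reducibility: `MuchnikLe P Q` iff every member of `Q` computes a member of `P`. -/
noncomputable def MuchnikLe (P Q : Set (Set ℕ)) : Prop :=
  ∀ B ∈ Q, ∃ A ∈ P, TRed A B

/-- A set of naturals is computably enumerable. -/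
def CE (W : Set ℕ) : Prop :=
  ∃ g : ℕ →. ℕ, RecIn (fun _ => 0) g ∧ ∀ n, n ∈ W ↔ (g n).Dom

/-- A Martin-Löf test: a uniformly c.e. sequence of sets of strings `U n`,
with the open set generated by `U n` having measure at most `2^{-n}`. -/
def MLTest (U : ℕ → Set (List Bool)) : Prop :=
  CE {p : ℕ | ∃ σ ∈ U (Nat.unpair p).1, (Nat.unpair p).2 = Encodable.encode σ} ∧
  ∀ n, (∑' σ : (U n), ((1 : ENNReal) / 2) ^ (σ : List Bool).length) ≤ (1 / 2) ^ n

/-- A set is 1-random (Martin-Löf random) if for every Martin-Löf test there is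
an `n` such that no initial segment of the set lies in `U n`. -/
noncomputable def MLRandom (A : Set ℕ) : Prop :=
  ∀ U : ℕ → Set (List Bool), MLTest U → ∃ n, ∀ m, seg A m ∉ U n

open scoped Classical
open Nat.Partrec (Code)

theorem pbind (p : Part ℕ) (f : ℕ →. ℕ) : (p >>= f) = Part.bind p (fun x => f x) := rfl

theorem mem_rfind_aux (p : ℕ → Part Bool) (n : ℕ) :
    n ∈ Nat.rfind p ↔ true ∈ p n ∧ ∀ {m : ℕ}, m < n → false ∈ p m := Nat.mem_rfind

/-- evaluation with partial oracle -/
def evalp (o : ℕ →. ℕ) : OCode → ℕ →. ℕ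
  | .zero => fun _ => Part.some 0
  | .succ => fun n => Part.some (n + 1)
  | .left => fun n => Part.some (Nat.unpair n).1
  | .right => fun n => Part.some (Nat.unpair n).2
  | .oracle => o
  | .pair cf cg => fun n => Nat.pair <$> evalp o cf n <*> evalp o cg n
  | .comp cf cg => fun n => evalp o cg n >>= evalp o cf
  | .prec cf cg =>
      Nat.unpaired fun a n =>
        n.rec (evalp o cf a) fun y IH => do
          let i ← IH
          evalp o cg (Nat.pair a (Nat.pair y i))
  | .rfind' cf =>
      Nat.unpaired fun a m =>
        (Nat.rfind fun n => (fun x => x = 0) <$> evalp o cf (Nat.pair a (n + m))).map (· + m)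

theorem evalo_eq_evalp (O : ℕ → ℕ) (c : OCode) : evalo O c = evalp (fun n => Part.some (O n)) c := by
  induction c with
  | pair f g hf hg => simp only [evalo, evalp, hf, hg]; rfl
  | comp f g hf hg => simp only [evalo, evalp, hf, hg]; rfl
  | prec f g hf hg => simp only [evalo, evalp, hf, hg]; rfl
  | rfind' f hf => simp only [evalo, evalp, hf]; rfl
  | _ => rfl

theorem evalp_mono {o o' : ℕ →. ℕ} (h : ∀ x y, y ∈ o x → y ∈ o' x) (c : OCode) :
    ∀ x y, y ∈ evalp o c x → y ∈ evalp o' c x := by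
  induction c with
  | zero => intro x y; exact id
  | succ => intro x y; exact id
  | left => intro x y; exact id
  | right => intro x y; exact id
  | oracle => exact h
  | pair f g hf hg =>
    intro x y hy
    simp only [evalp, Seq.seq, Part.map_eq_map, Part.mem_bind_iff, Part.mem_map_iff,
      exists_exists_and_eq_and] at hy ⊢
    obtain ⟨a, ha, b, hb, e⟩ := hy
    exact ⟨a, hf _ _ ha, b, hg _ _ hb, e⟩
  | comp f g hf hg =>
    intro x y hy
    simp only [evalp, pbind, Part.mem_bind_iff] at hy ⊢
    obtain ⟨a, ha, hb⟩ := hy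
    exact ⟨a, hg _ _ ha, hf _ _ hb⟩
  | prec f g hf hg =>
    intro x y hy
    simp only [evalp, Nat.unpaired] at hy ⊢
    generalize x.unpair.2 = n at hy ⊢
    induction n generalizing y with
    | zero => exact hf _ _ hy
    | succ n ih =>
      simp only [Part.bind_eq_bind, Part.mem_bind_iff] at hy ⊢
      obtain ⟨a, ha, hb⟩ := hy
      exact ⟨a, ih _ ha, hg _ _ hb⟩
  | rfind' f hf =>
    intro x y hy
    simp only [evalp, Nat.unpaired, Part.mem_map_iff, mem_rfind_aux, Part.map_eq_map] at hy ⊢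
    obtain ⟨a, ⟨⟨z, hz, hz'⟩, hb⟩, e⟩ := hy
    refine ⟨a, ⟨⟨z, hf _ _ hz, hz'⟩, ?_⟩, e⟩
    intro m hm
    obtain ⟨z, hz, hz'⟩ := hb hm
    exact ⟨z, hf _ _ hz, hz'⟩

theorem evalp_compact {o : ℕ → ℕ →. ℕ} {O : ℕ →. ℕ} (hm : ∀ n n', n ≤ n' → ∀ x y, y ∈ o n x → y ∈ o n' x)
    (h : ∀ x y, y ∈ O x → ∃ n, y ∈ o n x) (c : OCode) :
    ∀ x y, y ∈ evalp O c x → ∃ n, y ∈ evalp (o n) c x := by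
  have mono : ∀ {c n n' x y}, n ≤ n' → y ∈ evalp (o n) c x → y ∈ evalp (o n') c x :=
    fun hn hy => evalp_mono (hm _ _ hn) _ _ _ hy
  induction c with
  | zero => intro x y h; exact ⟨0, h⟩
  | succ => intro x y h; exact ⟨0, h⟩
  | left => intro x y h; exact ⟨0, h⟩
  | right => intro x y h; exact ⟨0, h⟩
  | oracle => exact h
  | pair f g hf hg =>
    intro x y hy
    simp only [evalp, Seq.seq, Part.map_eq_map, Part.mem_bind_iff, Part.mem_map_iff,
      exists_exists_and_eq_and] at hy ⊢
    obtain ⟨a, ha, b, hb, e⟩ := hy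
    obtain ⟨n, ha⟩ := hf _ _ ha
    obtain ⟨n', hb⟩ := hg _ _ hb
    exact ⟨max n n', a, mono (le_max_left _ _) ha, b, mono (le_max_right _ _) hb, e⟩
  | comp f g hf hg =>
    intro x y hy
    simp only [evalp, pbind, Part.mem_bind_iff] at hy ⊢
    obtain ⟨a, ha, hb⟩ := hy
    obtain ⟨n, ha⟩ := hg _ _ ha
    obtain ⟨n', hb⟩ := hf _ _ hb
    exact ⟨max n n', a, mono (le_max_left _ _) ha, mono (le_max_right _ _) hb⟩
  | prec f g hf hg =>
    intro x y hy
    simp only [evalp, Nat.unpaired] at hy ⊢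
    generalize x.unpair.2 = n at hy ⊢
    generalize x.unpair.1 = x at hy ⊢
    have key : ∀ (k n n' y : ℕ), n ≤ n' → y ∈ (Nat.rec (evalp (o n) f x) (fun y IH => do
          let i ← IH
          evalp (o n) g (Nat.pair x (Nat.pair y i))) k : Part ℕ) → y ∈ (Nat.rec (evalp (o n') f x) (fun y IH => do
          let i ← IH
          evalp (o n') g (Nat.pair x (Nat.pair y i))) k : Part ℕ) := by
      intro k n n' y hn hy
      have := @mono (.prec f g) n n' (Nat.pair x k) y hn
      simp only [evalp, Nat.unpaired, Nat.unpair_pair] at this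
      exact this hy
    induction n generalizing y with
    | zero => exact hf _ _ hy
    | succ n ih =>
      simp only [Part.bind_eq_bind, Part.mem_bind_iff] at hy
      obtain ⟨a, ha, hb⟩ := hy
      obtain ⟨n1, ha⟩ := ih _ ha
      obtain ⟨n2, hb⟩ := hg _ _ hb
      refine ⟨max n1 n2, ?_⟩
      simp only [Part.bind_eq_bind, Part.mem_bind_iff]
      exact ⟨a, key _ _ _ _ (le_max_left _ _) ha, mono (le_max_right _ _) hb⟩
  | rfind' f hf =>
    intro x y hy
    simp only [evalp, Nat.unpaired, Part.mem_map_iff, mem_rfind_aux, Part.map_eq_map] at hy ⊢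
    obtain ⟨a, ⟨⟨z, hz, hz'⟩, hb⟩, e⟩ := hy
    obtain ⟨n, hz⟩ := hf _ _ hz
    have : ∀ k ≤ a, ∃ n, ∀ m < k, ∃ a ∈ evalp (o n) f (Nat.pair (Nat.unpair x).1 (m + (Nat.unpair x).2)), decide (a = 0) = false := by
      intro k
      induction k with
      | zero => intro _; exact ⟨0, by simp⟩
      | succ k ih =>
        intro hk
        obtain ⟨n1, h1⟩ := ih (by omega)
        obtain ⟨z, hz, hz'⟩ := @hb k (by omega)
        obtain ⟨n2, hz⟩ := hf _ _ hz
        refine ⟨max n1 n2, fun m hm => ?_⟩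
        rcases Nat.lt_succ_iff_lt_or_eq.1 hm with hm | rfl
        · obtain ⟨a, ha, h⟩ := h1 m hm
          exact ⟨a, mono (le_max_left _ _) ha, h⟩
        · exact ⟨z, mono (le_max_right _ _) hz, hz'⟩
    obtain ⟨n', h'⟩ := this a le_rfl
    refine ⟨max n n', a, ⟨⟨z, mono (le_max_left _ _) hz, hz'⟩, ?_⟩, e⟩
    intro m hm
    obtain ⟨z, hz, hz'⟩ := h' m hm
    exact ⟨z, mono (le_max_right _ _) hz, hz'⟩

/-- reassociation code -/
def casr : Code := .pair (.comp .left .left) (.pair (.comp .right .left) .right)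
def casl : Code := .pair (.pair .left (.comp .left .right)) (.comp .right .right)

@[simp] theorem eval_casr (b a k : ℕ) : casr.eval (Nat.pair (Nat.pair b a) k) = Part.some (Nat.pair b (Nat.pair a k)) := by
  simp [casr, Code.eval, Seq.seq, pbind]
@[simp] theorem eval_casl (b a k : ℕ) : casl.eval (Nat.pair b (Nat.pair a k)) = Part.some (Nat.pair (Nat.pair b a) k) := by
  simp [casl, Code.eval, Seq.seq, pbind]

/-- translation to plain codes -/
def trc (orc : Code) : OCode → Code
  | .zero => .zero
  | .succ => .comp .succ .right
  | .left => .comp .left .right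
  | .right => .comp .right .right
  | .oracle => orc
  | .pair f g => .pair (trc orc f) (trc orc g)
  | .comp f g => .comp (trc orc f) (.pair .left (trc orc g))
  | .prec f g => .comp (.prec (trc orc f) (.comp (trc orc g) casr)) casl
  | .rfind' f => .comp (.rfind' (.comp (trc orc f) casr)) casl

theorem eval_trc (orc : Code) (b : ℕ) (c : OCode) :
    ∀ x, (trc orc c).eval (Nat.pair b x) = evalp (fun x => orc.eval (Nat.pair b x)) c x := by
  induction c with
  | zero => intro x; simp [trc, Code.eval, evalp]; rfl
  | succ => intro x; simp [trc, Code.eval, evalp, pbind]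
  | left => intro x; simp [trc, Code.eval, evalp, pbind]
  | right => intro x; simp [trc, Code.eval, evalp, pbind]
  | oracle => intro x; simp [trc, evalp]
  | pair f g hf hg => intro x; simp [trc, Code.eval, evalp, hf, hg]
  | comp f g hf hg => intro x; simp [trc, Code.eval, evalp, hf, hg, Seq.seq, Part.bind_map, pbind]
  | prec f g hf hg =>
    intro x
    obtain ⟨a, n, rfl⟩ : ∃ a n, x = Nat.pair a n := ⟨_, _, (Nat.pair_unpair x).symm⟩
    simp only [trc, Code.eval, evalp, Nat.unpaired, eval_casl, Part.bind_eq_bind, Part.bind_some, Nat.unpair_pair]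
    congr 1
    · exact hf _
    · simp [hg, pbind]
  | rfind' f hf =>
    intro x
    obtain ⟨a, n, rfl⟩ : ∃ a n, x = Nat.pair a n := ⟨_, _, (Nat.pair_unpair x).symm⟩
    simp [trc, Code.eval, evalp, hf, Nat.unpaired, pbind]

open scoped Classical
open Nat.Partrec (Code)

/-- step of the strong recursion computing the translation. -/
def trStep (orc : Code) (l : List Code) : Option Code :=
  let n := l.length
  if n = 0 then some .zero else
  if n = 1 then some (.comp .succ .right) else
  if n = 2 then some (.comp .left .right) else
  if n = 3 then some (.comp .right .right) else
  if n = 4 then some orc else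
  let k := n - 5
  let m := k.div2.div2
  let c1 := l.getD m.unpair.1 .zero
  let c2 := l.getD m.unpair.2 .zero
  if k.bodd then
    (if k.div2.bodd then some (.comp (.rfind' (.comp (l.getD m .zero) casr)) casl)
     else some (.comp (.prec c1 (.comp c2 casr)) casl))
  else
    (if k.div2.bodd then some (.comp c1 (.pair .left c2))
     else some (.pair c1 c2))

theorem trStep_primrec (orc : Code) : Primrec (trStep orc) := by
  have hn : Primrec (fun l : List Code => l.length) := Primrec.list_length
  have hk : Primrec (fun l : List Code => l.length - 5) :=
    Primrec.nat_sub.comp hn (Primrec.const 5)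
  have hm : Primrec (fun l : List Code => (l.length - 5).div2.div2) :=
    Primrec.nat_div2.comp (Primrec.nat_div2.comp hk)
  have hget : ∀ {f : List Code → ℕ}, Primrec f → Primrec (fun l : List Code => l.getD (f l) Code.zero) :=
    fun hf => (Primrec.list_getD Code.zero).comp Primrec.id hf
  have h1 := hget (Primrec.fst.comp (Primrec.unpair.comp hm))
  have h2 := hget (Primrec.snd.comp (Primrec.unpair.comp hm))
  have h0 := hget hm
  have hb1 : Primrec (fun l : List Code => (l.length - 5).bodd) := Primrec.nat_bodd.comp hk
  have hb2 : Primrec (fun l : List Code => (l.length - 5).div2.bodd) :=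
    Primrec.nat_bodd.comp (Primrec.nat_div2.comp hk)
  have heq : ∀ c : ℕ, PrimrecPred (fun l : List Code => l.length = c) := fun c =>
    Primrec.eq.comp hn (Primrec.const c)
  have hB : ∀ {f : List Code → Bool}, Primrec f → PrimrecPred (fun l => f l = true) := fun hf =>
    Primrec.eq.comp hf (Primrec.const true)
  have C2 := @Nat.Partrec.Code.primrec₂_comp
  have P2 := @Nat.Partrec.Code.primrec₂_pair
  refine Primrec.ite (heq 0) (Primrec.const _) <| Primrec.ite (heq 1) (Primrec.const _) <|
    Primrec.ite (heq 2) (Primrec.const _) <| Primrec.ite (heq 3) (Primrec.const _) <|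
    Primrec.ite (heq 4) (Primrec.const _) <|
    Primrec.ite (hB hb1) (Primrec.ite (hB hb2) (Primrec.option_some.comp ?_) (Primrec.option_some.comp ?_)) (Primrec.ite (hB hb2) (Primrec.option_some.comp ?_) (Primrec.option_some.comp ?_))
  · exact C2.comp (Nat.Partrec.Code.primrec_rfind'.comp (C2.comp h0 (Primrec.const _))) (Primrec.const _)
  · exact C2.comp (Nat.Partrec.Code.primrec₂_prec.comp h1 (C2.comp h2 (Primrec.const _))) (Primrec.const _)
  · exact C2.comp h1 (P2.comp (Primrec.const _) h2)
  · exact P2.comp h1 h2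

theorem tr_primrec (orc : Code) : Primrec (fun n => trc orc (ofNatOCode n)) := by
  have := Primrec.nat_strong_rec (α := Unit) (fun _ n => trc orc (ofNatOCode n))
    (g := fun _ l => trStep orc l) ((trStep_primrec orc).comp Primrec.snd) (by
      intro _ n
      match n with
      | 0 => simp [trStep, ofNatOCode, trc]
      | 1 => simp [trStep, ofNatOCode, trc]
      | 2 => simp [trStep, ofNatOCode, trc]
      | 3 => simp [trStep, ofNatOCode, trc]
      | 4 => simp [trStep, ofNatOCode, trc]
      | n + 5 =>
        have hm : n.div2.div2 < n + 5 := by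
          rw [Nat.div2_val, Nat.div2_val]; omega
        have m1 : n.div2.div2.unpair.1 < n + 5 :=
          lt_of_le_of_lt (Nat.unpair_left_le _) hm
        have m2 : n.div2.div2.unpair.2 < n + 5 :=
          lt_of_le_of_lt (Nat.unpair_right_le _) hm
        have hget : ∀ j < n + 5, ((List.range (n + 5)).map (fun n => trc orc (ofNatOCode n))).getD j Code.zero = trc orc (ofNatOCode j) := by
          intro j hj
          simp [List.getD, hj]
        rw [trStep]
        simp only [List.length_map, List.length_range, Nat.add_sub_cancel, hget _ hm, hget _ m1, hget _ m2]
        rw [ofNatOCode]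
        cases n.bodd <;> cases n.div2.bodd <;> simp [trc])
  exact this.comp (Primrec.const ()) Primrec.id

/-- index of an oracle code -/
def encO : OCode → ℕ
  | .zero => 0
  | .succ => 1
  | .left => 2
  | .right => 3
  | .oracle => 4
  | .pair f g => 2 * (2 * Nat.pair (encO f) (encO g)) + 5
  | .comp f g => 2 * (2 * Nat.pair (encO f) (encO g) + 1) + 5
  | .prec f g => (2 * (2 * Nat.pair (encO f) (encO g)) + 1) + 5
  | .rfind' f => (2 * (2 * encO f + 1) + 1) + 5

theorem ofNat_encO (c : OCode) : ofNatOCode (encO c) = c := by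
  induction c <;> simp [encO, ofNatOCode, Nat.div2_val, *]

/-- constant codes -/
def constO : ℕ → OCode
  | 0 => .zero
  | n + 1 => .comp .succ (constO n)

theorem eval_constO (O : ℕ → ℕ) (n x : ℕ) : evalo O (constO n) x = Part.some n := by
  induction n with
  | zero => rfl
  | succ n ih => simp [constO, evalo, ih]

theorem constO_primrec : Primrec (fun n => encO (constO n)) := by
  have : Primrec (fun n : ℕ => Nat.rec (motive := fun _ => ℕ) 0 (fun _ i => 2 * (2 * Nat.pair 1 i + 1) + 5) n) := by
    refine Primrec.nat_rec₁ 0 (?_ : Primrec₂ (fun (_ : ℕ) (i : ℕ) => 2 * (2 * Nat.pair 1 i + 1) + 5))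
    have : Primrec (fun i : ℕ => 2 * (2 * Nat.pair 1 i + 1) + 5) :=
      Primrec.nat_add.comp (Primrec.nat_double.comp (Primrec.nat_double_succ.comp
        (Primrec₂.natPair.comp (Primrec.const 1) Primrec.id))) (Primrec.const 5)
    exact this.comp Primrec.snd
  refine this.of_eq fun n => ?_
  induction n with
  | zero => rfl
  | succ n ih => simp [constO, encO, ← ih]

theorem smnO (c : OCode) : ∃ g : ℕ → ℕ, Primrec g ∧ ∀ (O : ℕ → ℕ) a, Phi O (g a) (g a) = evalo O c a := by
  refine ⟨fun a => encO (.comp c (constO a)), ?_, fun O a => ?_⟩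
  · simp only [encO]
    exact Primrec.nat_add.comp (Primrec.nat_double.comp (Primrec.nat_double_succ.comp
        (Primrec₂.natPair.comp (Primrec.const _) constO_primrec))) (Primrec.const 5)
  · simp [Phi, ofNat_encO, evalo, eval_constO, pbind]

/-- identity code -/
def idO : OCode := .pair .left .right
@[simp] theorem eval_idO (O : ℕ → ℕ) (n : ℕ) : evalo O idO n = Part.some n := by
  simp [idO, evalo, Seq.seq]

theorem exists_codeO {O : ℕ → ℕ} {f : ℕ →. ℕ} (h : RecIn O f) : ∃ c, evalo O c = f := by
  induction h with
  | oracle => exact ⟨.oracle, rfl⟩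
  | zero => exact ⟨.zero, rfl⟩
  | succ => exact ⟨.succ, rfl⟩
  | left => exact ⟨.left, rfl⟩
  | right => exact ⟨.right, rfl⟩
  | pair _ _ hf hg =>
    obtain ⟨cf, rfl⟩ := hf
    obtain ⟨cg, rfl⟩ := hg
    exact ⟨.pair cf cg, rfl⟩
  | comp _ _ hf hg =>
    obtain ⟨cf, rfl⟩ := hf
    obtain ⟨cg, rfl⟩ := hg
    exact ⟨.comp cf cg, rfl⟩
  | prec _ _ hf hg =>
    obtain ⟨cf, rfl⟩ := hf
    obtain ⟨cg, rfl⟩ := hg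
    exact ⟨.prec cf cg, rfl⟩
  | rfind _ hf =>
    obtain ⟨cf, rfl⟩ := hf
    refine ⟨.comp (.rfind' cf) (.pair idO .zero), ?_⟩
    funext a
    have e : evalo O (.pair idO .zero) a = Part.some (Nat.pair a 0) := by
      simp [evalo, Seq.seq]
    show (evalo O (.pair idO .zero) a >>= evalo O (.rfind' cf)) = _
    rw [e, pbind, Part.bind_some]
    simp only [evalo, Nat.unpaired, Nat.unpair_pair, Nat.add_zero]
    exact Part.map_id' (fun _ => rfl) _

theorem RecIn.of_eq {O : ℕ → ℕ} {f g : ℕ →. ℕ} (hf : RecIn O f) (h : ∀ n, f n = g n) : RecIn O g := by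
  have : f = g := funext h
  rwa [← this]

theorem RecIn.of_partrec {O : ℕ → ℕ} {f : ℕ →. ℕ} (h : Nat.Partrec f) : RecIn O f := by
  induction h with
  | zero => exact .zero
  | succ => exact .succ
  | left => exact .left
  | right => exact .right
  | pair _ _ hf hg => exact .pair hf hg
  | comp _ _ hf hg => exact .comp hf hg
  | prec _ _ hf hg => exact .prec hf hg
  | rfind _ hf => exact .rfind hf

/-- total functions recursive in the oracle -/
def RecT (O : ℕ → ℕ) (f : ℕ → ℕ) : Prop := RecIn O (fun n => Part.some (f n))

theorem RecT.of_primrec {O f} (h : Primrec f) : RecT O f :=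
  RecIn.of_partrec (Partrec.nat_iff.1 h.to_comp)

theorem RecT.comp {O f g} (hf : RecT O f) (hg : RecT O g) : RecT O (fun n => f (g n)) := by
  have := RecIn.comp hf hg
  exact this.of_eq (fun n => by simp)

theorem RecT.pair {O f g} (hf : RecT O f) (hg : RecT O g) : RecT O (fun n => Nat.pair (f n) (g n)) := by
  have := RecIn.pair hf hg
  exact this.of_eq (fun n => by simp [Seq.seq])

theorem RecT.of_eq {O f g} (hf : RecT O f) (h : ∀ n, f n = g n) : RecT O g := by
  have : f = g := funext h
  rwa [← this]

theorem RecT.prec0 {O} {g : ℕ → ℕ} (a : ℕ) (hg : RecT O g) :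
    RecT O (fun n => Nat.rec (motive := fun _ => ℕ) a (fun _ i => g i) n) := by
  have h1 : RecT O (fun _ => a) := RecT.of_primrec (Primrec.const a)
  have h2 : RecT O (fun w => g w.unpair.2.unpair.2) :=
    hg.comp (RecT.of_primrec (Primrec.snd.comp (Primrec.unpair.comp (Primrec.snd.comp Primrec.unpair))))
  have h3 := (RecIn.comp (RecIn.prec h1 h2) (RecT.of_primrec (O := O) (f := fun n => Nat.pair 0 n)
    (Primrec₂.natPair.comp (Primrec.const 0) Primrec.id)))
  refine h3.of_eq fun n => ?_
  refine (Part.bind_some _ _).trans ?_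
  simp only [Nat.unpaired, Nat.unpair_pair]
  induction n with
  | zero => rfl
  | succ n ih => exact (congrArg (fun q : Part ℕ => q.bind fun i => Part.some (g i)) ih).trans (Part.bind_some _ _)

/-- `rfind` of a total function which has zeros. -/
theorem RecT.find {O} {g : ℕ → ℕ} (hg : RecT O g) (f : ℕ → ℕ)
    (h : ∀ a, g (Nat.pair a (f a)) = 0) (h' : ∀ a, ∀ x < f a, g (Nat.pair a x) ≠ 0) : RecT O f := by
  have := RecIn.rfind hg
  refine this.of_eq fun a => ?_
  rw [Part.eq_some_iff]
  simp only [Part.map_eq_map, Part.map_some, mem_rfind_aux]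
  simp [h]
  intro m hm
  simpa using h' a m hm

open scoped Classical
open Encodable

/-- total decoding -/
def decD (α : Type) [Encodable α] (d : α) (n : ℕ) : α := (decode n : Option α).getD d

@[simp] theorem decD_encode {α : Type} [Encodable α] (d a : α) : decD α d (encode a) = a := by
  simp [decD]

theorem decD_primrec {α : Type} [Primcodable α] (d : α) : Primrec (decD α d) :=
  Primrec.option_getD.comp Primrec.decode (Primrec.const d)

theorem seg_succ (A : Set ℕ) (n : ℕ) : seg A (n + 1) = seg A n ++ [decide (chi A n = 1)] := by
  simp [seg, List.range_succ, chi]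

@[simp] theorem seg_length (A : Set ℕ) (n : ℕ) : (seg A n).length = n := by simp [seg]

theorem seg_recT (A : Set ℕ) : RecT (chi A) (fun n => encode (seg A n)) := by
  have hp : Primrec (fun w : ℕ => encode (decD (List Bool) [] w.unpair.1 ++ [decide (w.unpair.2 = 1)])) := by
    refine Primrec.encode.comp (Primrec.list_concat.comp ((decD_primrec _).comp (Primrec.fst.comp Primrec.unpair)) ?_)
    exact (Primrec.eq.comp (Primrec.snd.comp Primrec.unpair) (Primrec.const 1)).decide
  have hl : Primrec (fun w : ℕ => (decD (List Bool) [] w).length) :=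
    Primrec.list_length.comp (decD_primrec _)
  have hid : RecT (chi A) (fun n => n) := RecT.of_primrec Primrec.id
  have hstep : RecT (chi A) (fun i => encode (decD (List Bool) [] i ++ [decide (chi A (decD (List Bool) [] i).length = 1)])) :=
    ((RecT.of_primrec hp).comp (hid.pair (RecT.comp (RecIn.oracle : RecT (chi A) (chi A)) (RecT.of_primrec hl)))).of_eq
      (fun n => by simp)
  refine (RecT.prec0 (encode ([] : List Bool)) hstep).of_eq fun n => ?_
  induction n with
  | zero => simp [seg]
  | succ n ih => simp only [ih, seg_succ, decD_encode, seg_length]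

/-- Sigma-1 questions about `A` reduce to the jump of `A`. -/
theorem sigma_jump (A : Set ℕ) (Q : ℕ × ℕ × List Bool → Prop) (hQ : PrimrecPred Q) :
    ∃ g : ℕ → ℕ, Primrec g ∧ ∀ a, (g a ∈ jump A ↔ ∃ n, Q (a, n, seg A n)) := by
  have hF : Primrec (fun w : ℕ => if Q (w.unpair.1.unpair.1, w.unpair.1.unpair.2, decD (List Bool) [] w.unpair.2) then 0 else 1) := by
    refine Primrec.ite (hQ.comp ?_) (Primrec.const 0) (Primrec.const 1)
    have h1 := Primrec.unpair.comp (Primrec.fst.comp Primrec.unpair)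
    exact (Primrec.fst.comp h1).pair ((Primrec.snd.comp h1).pair ((decD_primrec _).comp (Primrec.snd.comp Primrec.unpair)))
  have hid : RecT (chi A) (fun n => n) := RecT.of_primrec Primrec.id
  have hG : RecT (chi A) (fun w : ℕ => if Q (w.unpair.1, w.unpair.2, seg A w.unpair.2) then 0 else 1) :=
    ((RecT.of_primrec hF).comp (hid.pair ((seg_recT A).comp (RecT.of_primrec (Primrec.snd.comp Primrec.unpair))))).of_eq
      (fun n => by simp)
  obtain ⟨c, hc⟩ := exists_codeO (RecIn.rfind hG)
  obtain ⟨g, hg, hg'⟩ := smnO c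
  refine ⟨g, hg, fun a => ?_⟩
  rw [jump, Set.mem_setOf_eq, hg', hc]
  simp only [Part.map_eq_map, Part.map_some]
  rw [Part.dom_iff_mem]
  simp only [mem_rfind_aux]
  simp only [Nat.unpair_pair, Part.mem_some_iff]
  constructor
  · rintro ⟨n, hn, _⟩
    refine ⟨n, ?_⟩
    by_contra h
    simp [h] at hn
  · intro h
    refine ⟨Nat.find h, ?_, ?_⟩
    · simp [Nat.find_spec h]
    · intro m hm
      simp [Nat.find_min h hm]

theorem sigma_low {L : Set ℕ} (hL : Low L) (Q : ℕ × ℕ × List Bool → Prop) (hQ : PrimrecPred Q) :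
    RecT (chi K) (fun a => if ∃ n, Q (a, n, seg L n) then 1 else 0) := by
  obtain ⟨g, hg, hg'⟩ := sigma_jump L Q hQ
  refine (RecT.comp (hL : RecT (chi K) (chi (jump L))) (RecT.of_primrec hg)).of_eq fun a => ?_
  simp [chi, hg']

theorem path_lemma {O : ℕ → ℕ} (P : List ℕ → Prop)
    (hP : RecT O (fun k => if P (decD (List ℕ) [] k) then 0 else 1)) (h0 : P [])
    (hs : ∀ p, P p → ∃ x, P (p ++ [x])) :
    ∃ f : ℕ → ℕ, (∀ n, P ((List.range n).map f)) ∧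
      RecT O (fun n => encode ((List.range n).map f)) := by
  let P' : List ℕ → ℕ → Prop := fun p x => P (p ++ [x]) ∨ ¬ P p
  have hex : ∀ p, ∃ x, P' p x := by
    intro p
    by_cases h : P p
    · obtain ⟨x, hx⟩ := hs p h
      exact ⟨x, Or.inl hx⟩
    · exact ⟨0, Or.inr h⟩
  let nx : List ℕ → ℕ := fun p => Nat.find (hex p)
  let st : ℕ → List ℕ := fun n => Nat.rec [] (fun _ p => p ++ [nx p]) n
  have st_succ : ∀ n, st (n + 1) = st n ++ [nx (st n)] := fun n => rfl
  have hst : ∀ n, P (st n) := by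
    intro n
    induction n with
    | zero => exact h0
    | succ n ih =>
      rw [st_succ]
      rcases Nat.find_spec (hex (st n)) with h | h
      · exact h
      · exact absurd ih h
  let f : ℕ → ℕ := fun n => nx (st n)
  have hf : ∀ n, (List.range n).map f = st n := by
    intro n
    induction n with
    | zero => rfl
    | succ n ih => rw [List.range_succ, List.map_append, ih, st_succ]; rfl
  refine ⟨f, fun n => by rw [hf]; exact hst n, ?_⟩
  simp only [hf]
  have hid : RecT O (fun n => n) := RecT.of_primrec Primrec.id
  have happ : Primrec (fun w : ℕ => encode (decD (List ℕ) [] w.unpair.1 ++ [w.unpair.2])) :=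
    Primrec.encode.comp (Primrec.list_concat.comp ((decD_primrec _).comp (Primrec.fst.comp Primrec.unpair)) (Primrec.snd.comp Primrec.unpair))
  have hc : Primrec (fun w : ℕ => w.unpair.1 * (1 - w.unpair.2)) :=
    Primrec.nat_mul.comp (Primrec.fst.comp Primrec.unpair) (Primrec.nat_sub.comp (Primrec.const 1) (Primrec.snd.comp Primrec.unpair))
  have h1 : RecT O (fun w => if P' (decD (List ℕ) [] w.unpair.1) w.unpair.2 then 0 else 1) := by
    refine ((RecT.of_primrec hc).comp ((hP.comp (RecT.of_primrec happ)).pair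
      (hP.comp (RecT.of_primrec (Primrec.fst.comp Primrec.unpair))))).of_eq fun w => ?_
    simp only [Nat.unpair_pair, decD_encode, P']
    by_cases ha : P (decD (List ℕ) [] w.unpair.1 ++ [w.unpair.2]) <;>
    by_cases hb : P (decD (List ℕ) [] w.unpair.1) <;> simp [ha, hb]
  have h2 : RecT O (fun i => nx (decD (List ℕ) [] i)) := by
    refine h1.find _ ?_ ?_
    · intro a
      simp only [Nat.unpair_pair]
      exact if_pos (Nat.find_spec (hex _))
    · intro a x hx
      simp only [Nat.unpair_pair]
      rw [if_neg (Nat.find_min (hex _) hx)]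
      exact one_ne_zero
  have h3 : RecT O (fun i => encode (decD (List ℕ) [] i ++ [nx (decD (List ℕ) [] i)])) :=
    ((RecT.of_primrec happ).comp (hid.pair h2)).of_eq (fun n => by simp)
  refine (RecT.prec0 (encode ([] : List ℕ)) h3).of_eq fun n => ?_
  induction n with
  | zero => rfl
  | succ n ih => simp only [ih, st_succ, decD_encode]

open scoped Classical
open Encodable
open Nat.Partrec (Code)

def orcF (w : ℕ) : Option ℕ :=
  let b := decD (List Bool × List Bool) ([], []) w.unpair.1
  let x := w.unpair.2
  ((if x.bodd then b.2 else b.1)[x.div2]?).map Bool.toNat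

theorem orcF_primrec : Primrec orcF := by
  have hb : Primrec (fun w : ℕ => decD (List Bool × List Bool) ([], []) w.unpair.1) :=
    (decD_primrec _).comp (Primrec.fst.comp Primrec.unpair)
  have hx : Primrec (fun w : ℕ => w.unpair.2) := Primrec.snd.comp Primrec.unpair
  refine Primrec.option_map (Primrec.list_getElem?.comp (Primrec.ite (Primrec.eq.comp (Primrec.nat_bodd.comp hx) (Primrec.const true)) (Primrec.snd.comp hb) (Primrec.fst.comp hb)) (Primrec.nat_div2.comp hx)) ?_
  exact (Primrec.dom_bool _).comp Primrec.snd

theorem exists_orc : ∃ c : Code, ∀ w, c.eval w = (orcF w : Part ℕ) := by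
  obtain ⟨c, hc⟩ := Nat.Partrec.Code.exists_code.1 (Partrec.nat_iff.1 (Computable.ofOption orcF_primrec.to_comp))
  exact ⟨c, fun w => by rw [hc]⟩

noncomputable def orc : Code := exists_orc.choose
theorem orc_eval (w : ℕ) : orc.eval w = (orcF w : Part ℕ) := exists_orc.choose_spec w

noncomputable def tr (e : ℕ) : Code := trc orc (ofNatOCode e)

def finO (α σ : List Bool) : ℕ →. ℕ := fun x => (orcF (Nat.pair (encode (α, σ)) x) : Part ℕ)

theorem seg_getElem? (A : Set ℕ) (n i : ℕ) : (seg A n)[i]? = if i < n then some (decide (i ∈ A)) else none := by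
  by_cases h : i < n <;> simp [seg, h]

theorem mem_finO (L B : Set ℕ) (n x y : ℕ) :
    y ∈ finO (seg L n) (seg B n) x ↔ x.div2 < n ∧ y = chi (join L B) x := by
  have hx : x = 2 * x.div2 ∨ x = 2 * x.div2 + 1 := by rw [Nat.div2_val]; omega
  unfold finO orcF
  simp only [Nat.unpair_pair, decD_encode]
  have hj : chi (join L B) x = if (if x.bodd then x.div2 ∈ B else x.div2 ∈ L) then 1 else 0 := by
    unfold chi
    congr 1
    rw [join, Set.mem_setOf_eq]
    have h2 := Nat.bodd_add_div2 x
    rcases hb : x.bodd with _ | _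
    · simp [hb] at h2 ⊢
      constructor
      · rintro (⟨a, ha, e⟩ | ⟨a, ha, e⟩)
        · rwa [show x.div2 = a by omega]
        · omega
      · intro h
        exact Or.inl ⟨_, h, h2.symm⟩
    · simp [hb] at h2 ⊢
      constructor
      · rintro (⟨a, ha, e⟩ | ⟨a, ha, e⟩)
        · omega
        · rwa [show x.div2 = a by omega]
      · intro h
        exact Or.inr ⟨_, h, by omega⟩
  rw [hj]
  have : (if x.bodd = true then seg B n else seg L n)[x.div2]? = if x.div2 < n then some (decide (if x.bodd then x.div2 ∈ B else x.div2 ∈ L)) else none := by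
    cases x.bodd <;> simp [seg_getElem?]
  rw [this]
  by_cases h : x.div2 < n
  · simp only [h, if_true]
    by_cases h' : (if x.bodd = true then x.div2 ∈ B else x.div2 ∈ L) <;> simp [h']
  · simp [h]

theorem phi_join (L B : Set ℕ) (e : ℕ) :
    (Phi (chi (join L B)) e e).Dom ↔ ∃ n, ((tr e).eval (Nat.pair (encode (seg L n, seg B n)) e)).Dom := by
  have hfin : ∀ n, (tr e).eval (Nat.pair (encode (seg L n, seg B n)) e) = evalp (finO (seg L n) (seg B n)) (ofNatOCode e) e := by
    intro n
    rw [tr, eval_trc]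
    simp only [orc_eval]
    rfl
  simp only [hfin, Phi, evalo_eq_evalp, Part.dom_iff_mem]
  constructor
  · rintro ⟨y, hy⟩
    have := evalp_compact (o := fun n => finO (seg L n) (seg B n)) (O := fun n => Part.some (chi (join L B) n)) ?_ ?_ _ _ _ hy
    · obtain ⟨n, hn⟩ := this
      exact ⟨n, y, hn⟩
    · intro n n' hn x y
      simp only [mem_finO]
      rintro ⟨h1, h2⟩
      exact ⟨by omega, h2⟩
    · intro x y hy
      exact ⟨x.div2 + 1, (mem_finO _ _ _ _ _).2 ⟨by omega, by simpa using hy⟩⟩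
  · rintro ⟨n, y, hy⟩
    refine ⟨y, evalp_mono ?_ _ _ _ hy⟩
    intro x y h
    simpa using ((mem_finO _ _ _ _ _).1 h).2

/-- bounded approximation to halting -/
def Rc (e : ℕ) (α σ : List Bool) : Prop :=
  ∃ j < σ.length + 1, (Nat.Partrec.Code.evaln σ.length (tr e) (Nat.pair (encode (α.take j, σ.take j)) e)).isSome = true

theorem exlt_primrec {α β : Type} [Primcodable α] [Primcodable β] {R : ℕ → β → Prop} (h : PrimrecRel R)
    {g : α → ℕ} (hg : Primrec g) {u : α → β} (hu : Primrec u) : PrimrecPred (fun a => ∃ j < g a, R j (u a)) := by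
  have h1 := PrimrecRel.comp (PrimrecRel.exists_mem_list h) (Primrec.list_range.comp hg) hu
  exact h1.of_eq (fun a => by simp)

theorem Rc_primrec : PrimrecPred (fun w : ℕ × List Bool × List Bool => Rc w.1 w.2.1 w.2.2) := by
  have h : PrimrecRel (fun (j : ℕ) (w : ℕ × List Bool × List Bool) =>
    (Nat.Partrec.Code.evaln w.2.2.length (tr w.1) (Nat.pair (encode (w.2.1.take j, w.2.2.take j)) w.1)).isSome = true) := by
    have h1 : Primrec (fun v : ℕ × ℕ × List Bool × List Bool => v.2.1) := Primrec.fst.comp Primrec.snd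
    have h2 : Primrec (fun v : ℕ × ℕ × List Bool × List Bool => v.2.2.1) := Primrec.fst.comp (Primrec.snd.comp Primrec.snd)
    have h3 : Primrec (fun v : ℕ × ℕ × List Bool × List Bool => v.2.2.2) := Primrec.snd.comp (Primrec.snd.comp Primrec.snd)
    have h4 := (Nat.Partrec.Code.primrec_evaln.comp (((Primrec.list_length.comp h3).pair ((tr_primrec orc).comp h1)).pair
      (Primrec₂.natPair.comp (Primrec.encode.comp ((Primrec.list_take.comp Primrec.fst h2).pair (Primrec.list_take.comp Primrec.fst h3))) h1)))
    exact Primrec.eq.comp (Primrec.option_isSome.comp h4) (Primrec.const true)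
  have hl : Primrec (fun w : ℕ × List Bool × List Bool => w.2.2.length + 1) :=
    Primrec.succ.comp (Primrec.list_length.comp (Primrec.snd.comp Primrec.snd))
  exact exlt_primrec h hl Primrec.id

def Rl (L : Set ℕ) (e : ℕ) (σ : List Bool) : Prop := Rc e (seg L σ.length) σ

theorem seg_take (A : Set ℕ) {n j : ℕ} (h : j ≤ n) : (seg A n).take j = seg A j := by
  simp [seg, ← List.map_take, List.take_range, h]

theorem Rc_iff (L : Set ℕ) (e : ℕ) {N : ℕ} {σ : List Bool} (h : σ.length ≤ N) :
    Rc e (seg L N) σ ↔ Rl L e σ := by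
  unfold Rl Rc
  refine exists_congr fun j => and_congr_right fun hj => ?_
  rw [seg_take _ (by omega), seg_take _ (by omega)]

theorem Rl_mono (L : Set ℕ) (e : ℕ) {σ τ : List Bool} (h : σ <+: τ) (hr : Rl L e σ) : Rl L e τ := by
  obtain ⟨j, hj, hv⟩ := hr
  have hl := h.length_le
  refine ⟨j, by omega, ?_⟩
  rw [seg_take _ (by omega)] at hv ⊢
  obtain ⟨ρ, rfl⟩ := h
  rw [List.take_append_of_le_length (by omega)]
  rw [Option.isSome_iff_exists] at hv ⊢
  obtain ⟨a, ha⟩ := hv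
  exact ⟨a, Nat.Partrec.Code.evaln_mono hl ha⟩

theorem seg_prefix (A : Set ℕ) {n m : ℕ} (h : n ≤ m) : seg A n <+: seg A m := by
  rw [← seg_take A h]; exact List.take_prefix _ _

theorem jump_join_iff (L B : Set ℕ) (e : ℕ) : e ∈ jump (join L B) ↔ ∃ n, Rl L e (seg B n) := by
  rw [jump, Set.mem_setOf_eq, phi_join]
  constructor
  · rintro ⟨n, hn⟩
    rw [Part.dom_iff_mem] at hn
    obtain ⟨y, hy⟩ := hn
    obtain ⟨k, hk⟩ := Nat.Partrec.Code.evaln_complete.1 hy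
    refine ⟨max n k, n, by simp, ?_⟩
    rw [seg_length, seg_take _ (le_max_left _ _), seg_take _ (le_max_left _ _), Option.isSome_iff_exists]
    exact ⟨y, Nat.Partrec.Code.evaln_mono (le_max_right _ _) hk⟩
  · rintro ⟨n, j, hj, h⟩
    rw [seg_length] at hj h
    rw [seg_take _ (by omega), seg_take _ (by omega), Option.isSome_iff_exists] at h
    obtain ⟨y, hy⟩ := h
    exact ⟨j, Part.dom_iff_mem.2 ⟨y, Nat.Partrec.Code.evaln_sound hy⟩⟩

open scoped Classical

def strs : ℕ → List (List Bool)
  | 0 => [[]]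
  | m + 1 => (strs m).map (List.cons false) ++ (strs m).map (List.cons true)

theorem strs_len {m : ℕ} {ρ : List Bool} (h : ρ ∈ strs m) : ρ.length = m := by
  induction m generalizing ρ with
  | zero => simp [strs] at h; simp [h]
  | succ m ih =>
    simp only [strs, List.mem_append, List.mem_map] at h
    rcases h with ⟨a, ha, rfl⟩ | ⟨a, ha, rfl⟩ <;> simp [ih ha]

noncomputable def cnt (X : List Bool → Prop) (m : ℕ) (σ : List Bool) : ℕ :=
  ((strs m).filter (fun ρ => X (σ ++ ρ))).length

theorem cnt_zero (X : List Bool → Prop) (σ : List Bool) : cnt X 0 σ = if X σ then 1 else 0 := by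
  by_cases h : X σ <;> simp [cnt, strs, h]

theorem cnt_succ (X : List Bool → Prop) (m : ℕ) (σ : List Bool) :
    cnt X (m + 1) σ = cnt X m (σ ++ [false]) + cnt X m (σ ++ [true]) := by
  simp [cnt, strs, List.filter_append, List.filter_map, Function.comp_def]

theorem cnt_congr {X Y : List Bool → Prop} {m : ℕ} {σ : List Bool}
    (h : ∀ τ, τ.length = σ.length + m → (X τ ↔ Y τ)) : cnt X m σ = cnt Y m σ := by
  unfold cnt
  congr 1
  apply List.filter_congr
  intro ρ hρ
  rw [decide_eq_decide]
  exact h _ (by simp [strs_len hρ])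

theorem cnt_union {X Y Z : List Bool → Prop} (h : ∀ τ, X τ → Y τ ∨ Z τ) (m : ℕ) (σ : List Bool) :
    cnt X m σ ≤ cnt Y m σ + cnt Z m σ := by
  induction m generalizing σ with
  | zero =>
    simp only [cnt_zero]
    have := h σ
    split_ifs <;> first | omega | tauto
  | succ m ih =>
    simp only [cnt_succ]
    have := ih (σ ++ [false]); have := ih (σ ++ [true]); omega

theorem cnt_disj {X Y Z : List Bool → Prop} (h1 : ∀ τ, Y τ → X τ) (h2 : ∀ τ, Z τ → X τ)
    (h : ∀ τ, Y τ → ¬ Z τ) (m : ℕ) (σ : List Bool) :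
    cnt Y m σ + cnt Z m σ ≤ cnt X m σ := by
  induction m generalizing σ with
  | zero =>
    simp only [cnt_zero]
    have := h σ; have := h1 σ; have := h2 σ
    split_ifs <;> first | omega | tauto
  | succ m ih =>
    simp only [cnt_succ]
    have := ih (σ ++ [false]); have := ih (σ ++ [true]); omega

def UpC (X : List Bool → Prop) : Prop := ∀ σ τ, σ <+: τ → X σ → X τ

theorem cnt_mono {X : List Bool → Prop} (hX : UpC X) (m : ℕ) (σ : List Bool) :
    2 * cnt X m σ ≤ cnt X (m + 1) σ := by
  induction m generalizing σ with
  | zero =>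
    simp only [cnt_succ, cnt_zero]
    have h1 := hX σ (σ ++ [false]) (List.prefix_append _ _)
    have h2 := hX σ (σ ++ [true]) (List.prefix_append _ _)
    split_ifs <;> first | omega | tauto
  | succ m ih =>
    rw [cnt_succ, cnt_succ X (m + 1)]
    have := ih (σ ++ [false]); have := ih (σ ++ [true]); omega

noncomputable def dens (X : List Bool → Prop) (m : ℕ) (σ : List Bool) : ℚ := cnt X m σ / 2 ^ m

theorem dens_nonneg (X : List Bool → Prop) (m : ℕ) (σ : List Bool) : 0 ≤ dens X m σ := by
  unfold dens; positivity

theorem dens_succ (X : List Bool → Prop) (m : ℕ) (σ : List Bool) :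
    2 * dens X (m + 1) σ = dens X m (σ ++ [false]) + dens X m (σ ++ [true]) := by
  unfold dens
  rw [cnt_succ, pow_succ]
  push_cast
  field_simp

theorem dens_le_one (X : List Bool → Prop) (m : ℕ) (σ : List Bool) : dens X m σ ≤ 1 := by
  induction m generalizing σ with
  | zero => simp only [dens, cnt_zero]; split_ifs <;> simp
  | succ m ih =>
    have := dens_succ X m σ
    have := ih (σ ++ [false]); have := ih (σ ++ [true]); linarith

theorem dens_mono {X : List Bool → Prop} (hX : UpC X) (σ : List Bool) :
    Monotone (fun m => dens X m σ) := by
  apply monotone_nat_of_le_succ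
  intro m
  have h : (2 : ℚ) * cnt X m σ ≤ cnt X (m + 1) σ := by exact_mod_cast cnt_mono hX m σ
  unfold dens
  rw [pow_succ, div_le_div_iff₀ (by positivity) (by positivity)]
  nlinarith [show (0 : ℚ) < 2 ^ m by positivity]

theorem dens_union {X Y Z : List Bool → Prop} (h : ∀ τ, X τ → Y τ ∨ Z τ) (m : ℕ) (σ : List Bool) :
    dens X m σ ≤ dens Y m σ + dens Z m σ := by
  unfold dens
  rw [← add_div]
  gcongr
  exact_mod_cast cnt_union h m σ

theorem dens_disj {X Y Z : List Bool → Prop} (h1 : ∀ τ, Y τ → X τ) (h2 : ∀ τ, Z τ → X τ)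
    (h : ∀ τ, Y τ → ¬ Z τ) (m : ℕ) (σ : List Bool) :
    dens Y m σ + dens Z m σ ≤ dens X m σ := by
  unfold dens
  rw [← add_div]
  gcongr
  exact_mod_cast cnt_disj h1 h2 h m σ

theorem exists_sat (u : ℕ → ℚ) (hu : Monotone u) (h0 : ∀ m, 0 ≤ u m) (h1 : ∀ m, u m ≤ 1) {ε : ℚ} (hε : 0 < ε) :
    ∃ m₀, ∀ m, u m - u m₀ ≤ ε := by
  by_contra hcon
  push Not at hcon
  have : ∀ k : ℕ, ∃ m, k * ε ≤ u m := by
    intro k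
    induction k with
    | zero => exact ⟨0, by simpa using h0 0⟩
    | succ k ih =>
      obtain ⟨m, hm⟩ := ih
      obtain ⟨m', hm'⟩ := hcon m
      exact ⟨m', by push_cast; linarith⟩
  obtain ⟨k, hk⟩ := exists_nat_gt (1 / ε)
  obtain ⟨m, hm⟩ := this k
  rw [div_lt_iff₀ hε] at hk
  have := h1 m
  linarith

def Bad (R : ℕ → List Bool → Prop) (p : List ℕ) (τ : List Bool) : Prop :=
  ∃ e < p.length, R e τ ∧ ¬ R e (τ.take (p.getD e 0).div2)

def sg (p : List ℕ) : List Bool := p.map Nat.bodd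

def OK (M : List Bool → ℚ) (c : ℕ) (R : ℕ → List Bool → Prop) (p : List ℕ) : Prop :=
  ∀ m, M (sg p) / c + dens (Bad R p) m (sg p) ≤ 1 - (1 / 2) ^ (p.length + 1)

theorem upc_new {R : List Bool → Prop} (hR : UpC R) (l : ℕ) :
    UpC (fun τ => R τ ∧ ¬ R (τ.take l)) := by
  rintro σ τ h ⟨h1, h2⟩
  refine ⟨hR _ _ h h1, ?_⟩
  by_cases hl : l ≤ σ.length
  · obtain ⟨ρ, rfl⟩ := h
    rwa [List.take_append_of_le_length hl]
  · rw [List.take_of_length_le (by omega)] at h2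
    exact absurd h1 h2

theorem upc_bad {R : ℕ → List Bool → Prop} (hR : ∀ e, UpC (R e)) (p : List ℕ) : UpC (Bad R p) := by
  rintro σ τ h ⟨e, he, h'⟩
  exact ⟨e, he, upc_new (hR e) _ _ _ h h'⟩

theorem OK_step {M : List Bool → ℚ} (hM : IsMartingale M) {c : ℕ}
    {R : ℕ → List Bool → Prop} (hR : ∀ e, UpC (R e)) (p : List ℕ) (hp : OK M c R p) :
    ∃ x, OK M c R (p ++ [x]) := by
  set s := p.length with hs
  set σ := sg p with hσ
  have hσl : σ.length = s := by simp [hσ, sg, hs]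
  obtain ⟨m₀, hm₀⟩ := exists_sat (fun m => dens (R s) m σ) (dens_mono (hR s) σ)
    (fun m => dens_nonneg _ _ _) (fun m => dens_le_one _ _ _) (ε := (1 / 2) ^ (s + 2)) (by positivity)
  set l := σ.length + m₀ with hl
  let New : List Bool → Prop := fun τ => R s τ ∧ ¬ R s (τ.take l)
  have hNew : UpC New := upc_new (hR s) l
  let Y : List Bool → Prop := fun τ => R s (τ.take l)
  have hY : UpC Y := by
    intro a b h hY
    refine hR s _ _ ?_ hY
    exact h.take l
  have hNd : ∀ m, dens New m σ ≤ (1 / 2) ^ (s + 2) := by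
    intro m
    refine (dens_mono hNew σ (le_max_left m m₀)).trans ?_
    have h1 : dens New (max m m₀) σ + dens Y (max m m₀) σ ≤ dens (R s) (max m m₀) σ :=
      dens_disj (fun τ h => h.1) (fun τ h => hR s _ _ (List.take_prefix _ _) h) (fun τ h => h.2) _ _
    have h2 : dens Y m₀ σ ≤ dens Y (max m m₀) σ := dens_mono hY σ (le_max_right m m₀)
    have h3 : dens Y m₀ σ = dens (R s) m₀ σ := by
      unfold dens
      rw [cnt_congr (Y := R s)]
      intro τ hτ
      simp only [Y]
      rw [List.take_of_length_le (by omega)]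
    have := hm₀ (max m m₀)
    simp only at this ⊢
    linarith
  let W : List Bool → Prop := fun τ => Bad R p τ ∨ New τ
  have hW : UpC W := by
    rintro a b h (h' | h')
    · exact Or.inl (upc_bad hR p _ _ h h')
    · exact Or.inr (hNew _ _ h h')
  have hWd : ∀ m, M σ / c + dens W m σ ≤ 1 - (1 / 2) ^ (s + 2) := by
    intro m
    have h1 := dens_union (X := W) (Y := Bad R p) (Z := New) (fun τ h => h) m σ
    have h2 := hp m
    have h3 := hNd m
    have h4 : (1 / 2 : ℚ) ^ (s + 1) = 2 * (1 / 2) ^ (s + 2) := by rw [pow_succ _ (s + 1)]; ring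
    rw [← hs, h4] at h2
    linarith
  have hi : ∃ i : Bool, ∀ m, M (σ ++ [i]) / c + dens W m (σ ++ [i]) ≤ 1 - (1 / 2) ^ (s + 2) := by
    by_contra hcon
    push Not at hcon
    obtain ⟨m1, h1⟩ := hcon false
    obtain ⟨m2, h2⟩ := hcon true
    have h3 : dens W m1 (σ ++ [false]) ≤ dens W (max m1 m2) (σ ++ [false]) := dens_mono hW _ (le_max_left _ _)
    have h4 : dens W m2 (σ ++ [true]) ≤ dens W (max m1 m2) (σ ++ [true]) := dens_mono hW _ (le_max_right _ _)
    have h5 := dens_succ W (max m1 m2) σ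
    have h6 := hWd (max m1 m2 + 1)
    have h7 : 2 * (M σ / c) = M (σ ++ [false]) / c + M (σ ++ [true]) / c := by
      rw [← add_div, ← hM.2 σ]; ring
    linarith
  obtain ⟨i, hi⟩ := hi
  refine ⟨Nat.bit i l, ?_⟩
  have e1 : sg (p ++ [Nat.bit i l]) = σ ++ [i] := by simp [sg, hσ]
  intro m
  rw [e1, List.length_append, List.length_singleton]
  refine le_trans ?_ (hi m)
  have hsub : ∀ τ, Bad R (p ++ [Nat.bit i l]) τ → W τ ∨ False := by
    rintro τ ⟨e, he, h1, h2⟩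
    left
    rw [List.length_append, List.length_singleton] at he
    rcases Nat.lt_succ_iff_lt_or_eq.1 he with he | he
    · left
      rw [List.getD_append _ _ _ _ he] at h2
      exact ⟨e, he, h1, h2⟩
    · right
      subst he
      rw [List.getD_append_right _ _ _ _ le_rfl] at h2
      simp at h2
      exact ⟨h1, h2⟩
  have h0 : dens (fun _ => False) m (σ ++ [i]) = 0 := by simp [dens, cnt]
  have := dens_union hsub m (σ ++ [i])
  rw [h0] at this
  linarith

open Encodable
open scoped Classical

theorem strs_primrec : Primrec strs := by
  have h : Primrec₂ (fun (_ : ℕ) (i : List (List Bool)) => i.map (List.cons false) ++ i.map (List.cons true)) := by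
    have g : ∀ b : Bool, Primrec (fun v : ℕ × List (List Bool) => v.2.map (List.cons b)) := fun b =>
      Primrec.list_map Primrec.snd ((Primrec.list_cons.comp (Primrec.const b) Primrec.snd).to₂)
    exact Primrec.list_append.comp (g false) (g true)
  refine (Primrec.nat_rec₁ [[]] h).of_eq fun n => ?_
  induction n with
  | zero => rfl
  | succ n ih => simp only [strs, ← ih]

theorem two_pow_primrec : Primrec (fun n : ℕ => 2 ^ n) := by
  have h : Primrec₂ (fun (_ : ℕ) (i : ℕ) => i * 2) :=
    Primrec.nat_mul.comp Primrec.snd (Primrec.const 2)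
  refine (Primrec.nat_rec₁ 1 h).of_eq fun n => ?_
  induction n with
  | zero => rfl
  | succ n ih => simp only [pow_succ, ← ih]

theorem sg_primrec : Primrec sg :=
  Primrec.list_map Primrec.id (Primrec.nat_bodd.comp Primrec.snd).to₂

theorem Bad_primrec : PrimrecPred (fun w : List ℕ × List Bool × List Bool =>
    Bad (fun e σ => Rc e w.2.1 σ) w.1 w.2.2) := by
  have h : PrimrecRel (fun (e : ℕ) (w : List ℕ × List Bool × List Bool) =>
      Rc e w.2.1 w.2.2 ∧ ¬ Rc e w.2.1 (w.2.2.take (w.1.getD e 0).div2)) := by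
    have h1 : Primrec (fun v : ℕ × List ℕ × List Bool × List Bool => v.2.1) := Primrec.fst.comp Primrec.snd
    have h2 : Primrec (fun v : ℕ × List ℕ × List Bool × List Bool => v.2.2.1) := Primrec.fst.comp (Primrec.snd.comp Primrec.snd)
    have h3 : Primrec (fun v : ℕ × List ℕ × List Bool × List Bool => v.2.2.2) := Primrec.snd.comp (Primrec.snd.comp Primrec.snd)
    have a1 := Rc_primrec.comp (Primrec.fst.pair (h2.pair h3))
    have a2 := Rc_primrec.comp (Primrec.fst.pair (h2.pair (Primrec.list_take.comp
      (Primrec.nat_div2.comp ((Primrec.list_getD 0).comp h1 Primrec.fst)) h3)))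
    exact a1.and a2.not
  exact exlt_primrec h (Primrec.list_length.comp Primrec.fst) Primrec.id

theorem cnt_primrec : Primrec (fun w : List ℕ × List Bool × ℕ =>
    cnt (Bad (fun e σ => Rc e w.2.1 σ) w.1) w.2.2 (sg w.1)) := by
  have h : PrimrecRel (fun (ρ : List Bool) (w : List ℕ × List Bool × ℕ) =>
      Bad (fun e σ => Rc e w.2.1 σ) w.1 (sg w.1 ++ ρ)) := by
    have h1 : Primrec (fun v : List Bool × List ℕ × List Bool × ℕ => v.2.1) := Primrec.fst.comp Primrec.snd
    have h2 : Primrec (fun v : List Bool × List ℕ × List Bool × ℕ => v.2.2.1) := Primrec.fst.comp (Primrec.snd.comp Primrec.snd)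
    exact Bad_primrec.comp (h1.pair (h2.pair (Primrec.list_append.comp (sg_primrec.comp h1) Primrec.fst)))
  have h3 := Primrec₂.comp (PrimrecRel.listFilter h) (strs_primrec.comp (Primrec.snd.comp Primrec.snd)) Primrec.id
  exact (Primrec.list_length.comp h3).of_eq (fun w => by simp [cnt])

theorem encode_rat {q : ℚ} (hq : 0 ≤ q) :
    encode q = Nat.pair (2 * q.num.toNat) q.den := by
  obtain ⟨a, b, c, d⟩ := q
  have ha : 0 ≤ a := Rat.num_nonneg.2 hq
  obtain ⟨n, rfl⟩ := Int.eq_ofNat_of_zero_le ha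
  rfl

noncomputable def Qc (c : ℕ) (w : ℕ × ℕ × List Bool) : Prop :=
  let p := decD (List ℕ) [] w.1.unpair.1
  let k := w.1.unpair.2 - 1
  let num := k.unpair.1.div2
  let den := k.unpair.2
  let s := p.length
  let m := w.2.1 - s
  s ≤ w.2.1 ∧ den * c * 2 ^ m * 2 ^ (s + 1) <
    num * 2 ^ m * 2 ^ (s + 1) + cnt (Bad (fun e σ => Rc e w.2.2 σ) p) m (sg p) * den * c * 2 ^ (s + 1) + den * c * 2 ^ m

theorem Qc_primrec (c : ℕ) : PrimrecPred (Qc c) := by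
  have hp : Primrec (fun w : ℕ × ℕ × List Bool => decD (List ℕ) [] w.1.unpair.1) :=
    (decD_primrec _).comp (Primrec.fst.comp (Primrec.unpair.comp Primrec.fst))
  have hk : Primrec (fun w : ℕ × ℕ × List Bool => (w.1.unpair.2 - 1).unpair) :=
    Primrec.unpair.comp (Primrec.nat_sub.comp (Primrec.snd.comp (Primrec.unpair.comp Primrec.fst)) (Primrec.const 1))
  have hnum := Primrec.nat_div2.comp (Primrec.fst.comp hk)
  have hden := Primrec.nat_mul.comp (Primrec.snd.comp hk) (Primrec.const c)
  have hs := Primrec.list_length.comp hp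
  have hn : Primrec (fun w : ℕ × ℕ × List Bool => w.2.1) := Primrec.fst.comp Primrec.snd
  have ha : Primrec (fun w : ℕ × ℕ × List Bool => w.2.2) := Primrec.snd.comp Primrec.snd
  have hm := Primrec.nat_sub.comp hn hs
  have hm2 := two_pow_primrec.comp hm
  have hs2 := two_pow_primrec.comp (Primrec.succ.comp hs)
  have hc := cnt_primrec.comp (hp.pair (ha.pair hm))
  have h := (Primrec.nat_le.comp hs hn).and (Primrec.nat_lt.comp
    (Primrec.nat_mul.comp (Primrec.nat_mul.comp hden hm2) hs2)
    (Primrec.nat_add.comp (Primrec.nat_add.comp (Primrec.nat_mul.comp (Primrec.nat_mul.comp hnum hm2) hs2)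
      (Primrec.nat_mul.comp (Primrec.nat_mul.comp (Primrec.nat_mul.comp hc (Primrec.snd.comp hk)) (Primrec.const c)) hs2))
      (Primrec.nat_mul.comp hden hm2)))
  exact h.of_eq (fun w => Iff.rfl)

theorem Qc_iff (M : List Bool → ℚ) (hM : ∀ σ, 0 ≤ M σ) (c : ℕ) (hc : 0 < c) (L : Set ℕ) (p : List ℕ) :
    (∃ n, Qc c (Nat.pair (encode p) (fnOracle M (encode (sg p))), n, seg L n)) ↔ ¬ OK M c (Rl L) p := by
  have hsl : (sg p).length = p.length := by simp [sg]
  have key : ∀ m, Qc c (Nat.pair (encode p) (fnOracle M (encode (sg p))), p.length + m, seg L (p.length + m)) ↔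
      ¬ (M (sg p) / c + dens (Bad (Rl L) p) m (sg p) ≤ 1 - (1 / 2) ^ (p.length + 1)) := by
    intro m
    have hcn : cnt (Bad (fun e σ => Rc e (seg L (p.length + m)) σ) p) m (sg p) = cnt (Bad (Rl L) p) m (sg p) := by
      apply cnt_congr
      intro τ hτ
      rw [hsl] at hτ
      unfold Bad
      refine exists_congr fun e => and_congr_right fun he => ?_
      exact and_congr (Rc_iff L e (by omega)) (not_congr (Rc_iff L e (by rw [List.length_take]; omega)))
    have hf : fnOracle M (encode (sg p)) = encode (M (sg p)) + 1 := by simp [fnOracle]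
    simp only [Qc, Nat.unpair_pair, decD_encode, hf, Nat.add_sub_cancel, encode_rat (hM (sg p)),
      Nat.add_sub_cancel_left, hcn, Nat.le_add_right, true_and]
    rw [Nat.div2_val, Nat.mul_div_cancel_left _ (by norm_num : 0 < 2)]
    set q := M (sg p) with hq
    have hden : (0 : ℚ) < q.den := by exact_mod_cast q.den_pos
    have hc' : (0 : ℚ) < c := by exact_mod_cast hc
    have hqv : q = (q.num.toNat : ℚ) / q.den := by
      conv_lhs => rw [← Rat.num_div_den q]
      congr 1
      have : 0 ≤ q.num := Rat.num_nonneg.2 (hM _)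
      exact_mod_cast (Int.toNat_of_nonneg this).symm
    rw [not_le, dens]
    generalize q.num.toNat = a at *
    generalize q.den = d at *
    rw [hqv]
    generalize cnt (Bad (Rl L) p) m (sg p) = t
    rw [← Nat.cast_lt (α := ℚ)]
    push_cast
    rw [one_div, inv_pow]
    generalize hS : (2 : ℚ) ^ (p.length + 1) = S
    generalize hT : (2 : ℚ) ^ m = T
    have hS0 : 0 < S := by rw [← hS]; positivity
    have hT0 : 0 < T := by rw [← hT]; positivity
    have e1 : (a : ℚ) / d / c + t / T - (1 - S⁻¹) =
      (a * T * S + t * d * c * S + d * c * T - d * c * T * S) / (d * c * T * S) := by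
      field_simp
      ring
    have e2 : (1 - S⁻¹ < (a : ℚ) / d / c + t / T) ↔ 0 < (a : ℚ) / d / c + t / T - (1 - S⁻¹) := by
      rw [sub_pos]
    rw [e2, e1, div_pos_iff_of_pos_right (by positivity), sub_pos]
  unfold OK
  rw [not_forall]
  constructor
  · rintro ⟨n, hn⟩
    have hle : p.length ≤ n := by
      have := hn.1
      simpa using this
    obtain ⟨m, rfl⟩ := Nat.exists_eq_add_of_le hle
    exact ⟨m, (key m).1 hn⟩
  · rintro ⟨m, hm⟩
    exact ⟨_, (key m).2 hm⟩

theorem OK_recT {M : List Bool → ℚ} (hM : ∀ σ, 0 ≤ M σ) (hMK : FRed M K) {c : ℕ} (hc : 0 < c)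
    {L : Set ℕ} (hL : Low L) :
    RecT (chi K) (fun k => if OK M c (Rl L) (decD (List ℕ) [] k) then 0 else 1) := by
  have h1 := sigma_low hL (Qc c) (Qc_primrec c)
  have h2 : RecT (chi K) (fnOracle M) := hMK
  have h3 : Primrec (fun k => encode (sg (decD (List ℕ) [] k))) :=
    Primrec.encode.comp (sg_primrec.comp (decD_primrec _))
  have h4 : Primrec (fun k => encode (decD (List ℕ) [] k)) := Primrec.encode.comp (decD_primrec _)
  refine (h1.comp ((RecT.of_primrec h4).pair (h2.comp (RecT.of_primrec h3)))).of_eq fun k => ?_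
  simp only [Qc_iff M hM c hc L]
  split_ifs <;> rfl

theorem main6 (M : List Bool → ℚ) (hM : IsMartingale M) (hMK : FRed M K)
    (L : Set ℕ) (hL : Low L) :
    ∃ B : Set ℕ, ¬ Succeeds M B ∧ Low (join L B) := by
  obtain ⟨c, hc⟩ := exists_nat_gt (2 * M [])
  have hM0 := hM.1 []
  have hc0 : 0 < c := by
    have : (0 : ℚ) < c := by linarith
    exact_mod_cast this
  have hcq : (0 : ℚ) < c := by exact_mod_cast hc0
  have hR : ∀ e, UpC (Rl L e) := fun e σ τ h h' => Rl_mono L e h h'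
  have h0 : OK M c (Rl L) [] := by
    intro m
    have : dens (Bad (Rl L) []) m (sg []) = 0 := by simp [dens, cnt, Bad]
    rw [this]
    have : M (sg []) / c ≤ 1 / 2 := by
      rw [div_le_div_iff₀ hcq (by norm_num)]
      simp only [sg, List.map_nil]
      linarith
    norm_num at this ⊢
    linarith
  obtain ⟨f, hf, hfr⟩ := path_lemma (OK M c (Rl L)) (OK_recT hM.1 hMK hc0 hL) h0 (OK_step hM hR)
  let B : Set ℕ := {n | (f n).bodd = true}
  have hB : ∀ n, sg ((List.range n).map f) = seg B n := by
    intro n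
    simp [sg, seg, B]
  refine ⟨B, ?_, ?_⟩
  · intro hs
    obtain ⟨n, hn⟩ := hs c
    have h1 := hf n 0
    rw [hB] at h1
    have h2 := dens_nonneg (Bad (Rl L) ((List.range n).map f)) 0 (seg B n)
    have h3 : (0 : ℚ) < (1 / 2) ^ (((List.range n).map f).length + 1) := by positivity
    have h4 : 1 < M (seg B n) / c := by rwa [one_lt_div hcq]
    linarith
  · have hj : ∀ e, e ∈ jump (join L B) ↔ Rl L e (seg B (f e).div2) := by
      intro e
      rw [jump_join_iff]
      refine ⟨?_, fun h => ⟨_, h⟩⟩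
      rintro ⟨n, hn⟩
      by_contra hcon
      set N := max n (max (e + 1) (f e).div2) with hN
      have h1 := hf N 0
      rw [hB] at h1
      have hbad : Bad (Rl L) ((List.range N).map f) (seg B N) := by
        have he : e < N := by omega
        refine ⟨e, by simpa using he, Rl_mono L e (seg_prefix B (by omega)) hn, ?_⟩
        have : ((List.range N).map f).getD e 0 = f e := by simp [List.getD, he]
        rw [this, seg_take _ (by omega)]
        exact hcon
      have h2 : dens (Bad (Rl L) ((List.range N).map f)) 0 (seg B N) = 1 := by
        simp [dens, cnt_zero, hbad]
      have h3 : (0 : ℚ) < (1 / 2) ^ (((List.range N).map f).length + 1) := by positivity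
      have h4 : 0 ≤ M (seg B N) / c := div_nonneg (hM.1 _) hcq.le
      linarith
    have hQ : PrimrecPred (fun w : ℕ × ℕ × List Bool =>
        (decD (List Bool) [] w.1.unpair.2).length ≤ w.2.1 ∧ Rc w.1.unpair.1 w.2.2 (decD (List Bool) [] w.1.unpair.2)) := by
      have hσ : Primrec (fun w : ℕ × ℕ × List Bool => decD (List Bool) [] w.1.unpair.2) :=
        (decD_primrec _).comp (Primrec.snd.comp (Primrec.unpair.comp Primrec.fst))
      have he : Primrec (fun w : ℕ × ℕ × List Bool => w.1.unpair.1) :=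
        Primrec.fst.comp (Primrec.unpair.comp Primrec.fst)
      exact (Primrec.nat_le.comp (Primrec.list_length.comp hσ) (Primrec.fst.comp Primrec.snd)).and
        (Rc_primrec.comp (he.pair ((Primrec.snd.comp Primrec.snd).pair hσ)))
    have h1 := sigma_low hL _ hQ
    have hlast : RecT (chi K) (fun e => (f e).div2) := by
      have hp : Primrec (fun w : ℕ => ((decD (List ℕ) [] w.unpair.2).getD w.unpair.1 0).div2) :=
        Primrec.nat_div2.comp ((Primrec.list_getD 0).comp ((decD_primrec _).comp (Primrec.snd.comp Primrec.unpair))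
          (Primrec.fst.comp Primrec.unpair))
      refine ((RecT.of_primrec hp).comp ((RecT.of_primrec Primrec.id).pair
        (hfr.comp (RecT.of_primrec Primrec.succ)))).of_eq fun e => ?_
      simp [List.getD]
    have hsgr : RecT (chi K) (fun e => encode (seg B (f e).div2)) := by
      have hp : Primrec (fun w : ℕ => encode (sg (decD (List ℕ) [] w))) :=
        Primrec.encode.comp (sg_primrec.comp (decD_primrec _))
      refine ((RecT.of_primrec hp).comp (hfr.comp hlast)).of_eq fun e => ?_
      rw [decD_encode, hB]
    have h2 := h1.comp ((RecT.of_primrec Primrec.id).pair hsgr)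
    refine RecT.of_eq h2 fun e => ?_
    have : (∃ n, (decD (List Bool) [] (Nat.pair (id e) (encode (seg B (f e).div2))).unpair.2).length ≤ n ∧
        Rc (Nat.pair (id e) (encode (seg B (f e).div2))).unpair.1 (seg L n)
          (decD (List Bool) [] (Nat.pair (id e) (encode (seg B (f e).div2))).unpair.2)) ↔ e ∈ jump (join L B) := by
      rw [hj]
      simp only [Nat.unpair_pair, decD_encode, id]
      constructor
      · rintro ⟨n, h, h'⟩
        exact (Rc_iff L e h).1 h'
      · intro h
        exact ⟨_, le_rfl, (Rc_iff L e le_rfl).2 h⟩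
    simp only [chi, this]

/-- for every `∅'`-computable martingale `M` and every low set `L` there is
a set `B` on which `M` does not succeed with `L ⊕ B` low. -/
theorem stmt6 (M : List Bool → ℚ) (hM : IsMartingale M) (hMK : FRed M K)
    (L : Set ℕ) (hL : Low L) :
    ∃ B : Set ℕ, ¬ Succeeds M B ∧ Low (join L B) := by
  exact main6 M hM hMK L hL
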